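/- Let f be a smooth circle diffeomorphism with f(y) = π, f' > 0, f(x+2π)=f(x)+2π, and let u(x) = log(sin²((x-y)/2)) - log(cos²(f(x)/2)) + log(f'(x)) be its associated smooth periodic function. Then ∫₀^{2π} (e^{u(x)} - e^{u(y)})/sin²((x-y)/2) dx = 0. -/

import Mathlib

open Real

/-- Second-order l'Hôpital: if `N` vanishes to first order at `y`, then `N / (x - y)²` has a
limit at `y`. -/
lemma tendsto_div_sq_of_contDiff {N : ℝ → ℝ} (hN : ContDiff ℝ 2 N) {y : ℝ}
    (h0 : N y = 0) (h1 : deriv N y = 0) :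
    Filter.Tendsto (fun x => N x / (x - y) ^ 2) (nhdsWithin y {y}ᶜ)
      (nhds (deriv (deriv N) y / 2)) := by
  have hd : ContDiff ℝ 1 (deriv N) := by
    have h : ContDiff ℝ (1 + 1) N := by
      rw [one_add_one_eq_two]
      exact hN
    exact (contDiff_succ_iff_deriv.1 h).2.2
  have hslope := hasDerivAt_iff_tendsto_slope.1
    (hd.differentiable one_ne_zero y).hasDerivAt
  have hsq : ∀ x, HasDerivAt (fun x : ℝ => (x - y) ^ 2) (2 * (x - y)) x := fun x => by
    simpa using ((hasDerivAt_id x).sub_const y).fun_pow 2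
  refine HasDerivAt.lhopital_zero_nhdsNE (f' := deriv N) (g' := fun x => 2 * (x - y))
    (Filter.Eventually.of_forall fun x => (hN.differentiable two_ne_zero x).hasDerivAt)
    (Filter.Eventually.of_forall hsq) ?_ ?_ ?_ ?_
  · filter_upwards [self_mem_nhdsWithin] with x hx
    exact mul_ne_zero two_ne_zero (sub_ne_zero.2 hx)
  · have := hN.continuous.continuousAt (x := y)
    rw [ContinuousAt, h0] at this
    exact this.mono_left nhdsWithin_le_nhds
  · have := (hsq y).continuousAt
    simp only [ContinuousAt, sub_self, ne_eq, OfNat.ofNat_ne_zero, not_false_eq_true,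
      zero_pow] at this
    exact this.mono_left nhdsWithin_le_nhds
  · refine (hslope.div_const 2).congr fun x => ?_
    rw [slope_def_field, h1, sub_zero, div_div, mul_comm]

lemma hasDerivAt_cos_div_sin {g : ℝ → ℝ} {g' x : ℝ} (hg : HasDerivAt g g' x)
    (hs : Real.sin (g x) ≠ 0) :
    HasDerivAt (fun x => Real.cos (g x) / Real.sin (g x)) (-g' / Real.sin (g x) ^ 2) x := by
  refine (hg.cos.div hg.sin hs).congr_deriv ?_
  congr 1
  linear_combination (-g') * Real.sin_sq_add_cos_sq (g x)

lemma tendsto_sin_div_sub {g : ℝ → ℝ} {g' y : ℝ} (hg : HasDerivAt g g' y) (h0 : g y = 0) :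
    Filter.Tendsto (fun x => Real.sin (g x) / (x - y)) (nhdsWithin y {y}ᶜ) (nhds g') := by
  have h := hasDerivAt_iff_tendsto_slope.1 hg.sin
  simp only [h0, Real.cos_zero, one_mul] at h
  refine h.congr fun x => ?_
  rw [slope_def_field, h0, Real.sin_zero, sub_zero]

theorem teichmueller_integral_constraint (f : ℝ → ℝ)
    (hf : ContDiff ℝ (⊤ : ℕ∞) f) (hf' : ∀ x, 0 < deriv f x)
    (hfq : ∀ x, f (x + 2*π) = f x + 2*π)
    (y : ℝ) (hy : f y = π)
    (u : ℝ → ℝ) (hu : ContDiff ℝ (⊤ : ℕ∞) u) (huper : ∀ x, u (x + 2*π) = u x)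
    (huform : ∀ x, Real.cos (f x / 2) ≠ 0 →
      u x = Real.log ((Real.sin ((x - y)/2))^2)
          - Real.log ((Real.cos (f x / 2))^2) + Real.log (deriv f x)) :
    ∫ x in (0:ℝ)..(2*π),
      (Real.exp (u x) - Real.exp (u y)) / (Real.sin ((x - y)/2))^2 = 0 := by
  set F : ℝ → ℝ := fun x => (Real.exp (u x) - Real.exp (u y)) / (Real.sin ((x - y)/2))^2 with hF
  have hpi := Real.pi_pos
  have hlt : y < y + 2 * π := by linarith
  have hFper : Function.Periodic F (2 * π) := fun x => by
    have : (x + 2 * π - y) / 2 = (x - y) / 2 + π := by ring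
    simp only [hF, huper, this, Real.sin_add_pi, neg_sq]
  have hshift : ∫ x in (0:ℝ)..(2*π), F x = ∫ x in y..(y + 2*π), F x := by
    simpa using hFper.intervalIntegral_add_eq 0 y
  rw [hshift]
  by_cases hint : IntervalIntegrable F MeasureTheory.volume y (y + 2 * π)
  swap
  · exact intervalIntegral.integral_undef hint
  set h : ℝ → ℝ := fun x => (x - y) / 2 with hh
  set g : ℝ → ℝ := fun x => (f x - π) / 2 with hg
  have hmono : StrictMono f := strictMono_of_deriv_pos hf'
  have hfd : ∀ x, HasDerivAt f (deriv f x) x := fun x =>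
    (hf.differentiable (by simp) x).hasDerivAt
  have hhd : ∀ x, HasDerivAt h (1 / 2) x := fun x =>
    ((hasDerivAt_id x).sub_const y).div_const 2
  have hgd : ∀ x, HasDerivAt g (deriv f x / 2) x := fun x =>
    ((hfd x).sub_const π).div_const 2
  have hhy : h y = 0 := by simp [hh]
  have hgy : g y = 0 := by simp [hg, hy]
  have hsinh : ∀ x ∈ Set.Ioo y (y + 2 * π), 0 < Real.sin (h x) := fun x hx =>
    Real.sin_pos_of_pos_of_lt_pi (by simp only [hh]; linarith [hx.1])
      (by simp only [hh]; linarith [hx.2])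
  have hsing : ∀ x ∈ Set.Ioo y (y + 2 * π), 0 < Real.sin (g x) := fun x hx => by
    have h1 := hmono hx.1
    have h2 := hmono hx.2
    rw [hfq] at h2
    exact Real.sin_pos_of_pos_of_lt_pi (by simp only [hg]; linarith)
      (by simp only [hg]; linarith)
  have hcosg : ∀ x, Real.cos (f x / 2) = -Real.sin (g x) := fun x => by
    have : f x / 2 = g x + π / 2 := by simp only [hg]; ring
    rw [this, Real.cos_add_pi_div_two]
  have hexp : ∀ x ∈ Set.Ioo y (y + 2 * π),
      Real.exp (u x) = Real.sin (h x) ^ 2 / Real.sin (g x) ^ 2 * deriv f x := fun x hx => by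
    have h1 := hsinh x hx
    have h2 := hsing x hx
    have h3 := huform x (by rw [hcosg]; exact neg_ne_zero.2 h2.ne')
    rw [h3, hcosg, neg_sq, Real.exp_add, Real.exp_sub, Real.exp_log (hf' x),
      Real.exp_log (pow_pos h2 2), Real.exp_log (pow_pos h1 2)]
  have hsh := tendsto_sin_div_sub (hhd y) hhy
  have hsg := tendsto_sin_div_sub (hgd y) hgy
  have hfy := hf' y
  have hright : nhdsWithin y (Set.Ioi y) ≤ nhdsWithin y {y}ᶜ :=
    nhdsWithin_mono y fun x hx => ne_of_gt hx
  have hleft : nhdsWithin y (Set.Iio y) ≤ nhdsWithin y {y}ᶜ :=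
    nhdsWithin_mono y fun x hx => ne_of_lt hx
  have hfc : Continuous (deriv f) := hf.continuous_deriv (by simp)
  have hc : Real.exp (u y) = 1 / deriv f y := by
    have l1 : Filter.Tendsto (fun x => Real.exp (u x)) (nhdsWithin y (Set.Ioi y))
        (nhds (Real.exp (u y))) :=
      ((Real.continuous_exp.comp hu.continuous).tendsto y).mono_left nhdsWithin_le_nhds
    have l2 := (((hsh.pow 2).div (hsg.pow 2) (by positivity)).mono_left hright).mul
      ((hfc.tendsto y).mono_left nhdsWithin_le_nhds)
    have l3 := l2.congr' (f₂ := fun x => Real.exp (u x)) (by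
      filter_upwards [Ioo_mem_nhdsGT hlt] with x hx
      have : x - y ≠ 0 := sub_ne_zero.2 (ne_of_gt hx.1)
      have := (hsing x hx).ne'
      simp only [Pi.div_apply]
      rw [hexp x hx]
      field_simp)
    rw [tendsto_nhds_unique l1 l3]
    field_simp
  set c := Real.exp (u y) with hcdef
  set N : ℝ → ℝ := fun x => c * (Real.cos (h x) * Real.sin (g x))
    - Real.sin (h x) * Real.cos (g x) with hNdef
  have hN : ContDiff ℝ 2 N := by
    have hf2 : ContDiff ℝ 2 f := contDiff_infty.1 hf 2
    simp only [hNdef, hh, hg]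
    fun_prop
  have hN1 : deriv N y = 0 := by
    have := ((((hhd y).cos.mul (hgd y).sin).const_mul c).sub
      ((hhd y).sin.mul (hgd y).cos)).deriv
    refine this.trans ?_
    simp only [hhy, hgy, Real.sin_zero, Real.cos_zero, hc]
    field_simp
    ring
  have hlim := (tendsto_div_sq_of_contDiff hN (by simp [hNdef, hhy, hgy]) hN1).div
    (hsh.mul hsg) (by positivity)
  set Φ : ℝ → ℝ := fun x => 2 * (N x / (Real.sin (h x) * Real.sin (g x))) with hΦ
  have hΦlim : ∃ L, Filter.Tendsto Φ (nhdsWithin y {y}ᶜ) (nhds L) := by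
    refine ⟨_, (hlim.const_mul 2).congr' ?_⟩
    filter_upwards [self_mem_nhdsWithin] with x hx
    have hxy : x - y ≠ 0 := sub_ne_zero.2 hx
    simp only [hΦ, Pi.div_apply]
    rw [div_mul_div_comm, ← sq, div_div_div_cancel_right₀ (pow_ne_zero 2 hxy)]
  obtain ⟨L, hL⟩ := hΦlim
  have hΦper : ∀ x, Φ (x - 2 * π) = Φ x := fun x => by
    have e1 : h (x - 2 * π) = h x - π := by simp only [hh]; ring
    have e2 : g (x - 2 * π) = g x - π := by
      have := hfq (x - 2 * π)
      rw [sub_add_cancel] at this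
      simp only [hg]; linarith
    simp only [hΦ, hNdef, e1, e2, Real.sin_sub_pi, Real.cos_sub_pi]
    ring
  have hLend : Filter.Tendsto Φ (nhdsWithin (y + 2 * π) (Set.Iio (y + 2 * π))) (nhds L) := by
    have ht : Filter.Tendsto (fun x => x - 2 * π)
        (nhdsWithin (y + 2 * π) (Set.Iio (y + 2 * π))) (nhdsWithin y (Set.Iio y)) := by
      refine tendsto_nhdsWithin_iff.2 ⟨?_, ?_⟩
      · have : Continuous fun x : ℝ => x - 2 * π := by fun_prop
        have := this.tendsto (y + 2 * π)
        rw [add_sub_cancel_right] at this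
        exact this.mono_left nhdsWithin_le_nhds
      · filter_upwards [self_mem_nhdsWithin] with x hx
        exact sub_lt_iff_lt_add.2 (Set.mem_Iio.1 hx)
    exact ((hL.mono_left hleft).comp ht).congr hΦper
  have hderiv : ∀ x ∈ Set.Ioo y (y + 2 * π), HasDerivAt Φ (F x) x := fun x hx => by
    have h1 := (hsinh x hx).ne'
    have h2 := (hsing x hx).ne'
    have hd := ((hasDerivAt_cos_div_sin (hhd x) h1).const_mul (2 * c)).sub
      ((hasDerivAt_cos_div_sin (hgd x) h2).const_mul 2)
    refine (hd.congr_of_eventuallyEq ?_).congr_deriv ?_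
    · filter_upwards [isOpen_Ioo.mem_nhds hx] with z hz
      have h3 := (hsinh z hz).ne'
      have h4 := (hsing z hz).ne'
      simp only [hΦ, hNdef, Pi.sub_apply]
      field_simp
    · change _ = (Real.exp (u x) - c) / Real.sin (h x) ^ 2
      rw [hexp x hx]
      field_simp
      ring
  rw [intervalIntegral.integral_eq_sub_of_hasDerivAt_of_tendsto hlt hderiv hint
    (hL.mono_left hright) hLend, sub_self]
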